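/- arXiv:2309.05837 — 7 statements merged into one kernel-verified Lean document; each statement's English description precedes it below -/
import Mathlib

section
/- The maximal robust safe set Ω* satisfies: (i) Ω* ∩ F = ∅; (ii) there exists a single policy π : X → U such that Ω* is robustly controlled-invariant under π and π is robustly safe from every x ∈ Ω*; and (iii) every set that is robustly controlled-invariant under some policy and disjoint from F is contained in Ω*. In particular, Ω* is the unique maximal set with these properties. -/
/-- Closed-loop trajectory of the uncertain system `f` under policy `π`,
initial state `x₀`, and disturbance sequence `d`. -/
def traj {X U D : Type*} (f : X → U → D → X) (π : X → U) (x₀ : X) (d : ℕ → D) : ℕ → X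
  | 0 => x₀
  | t + 1 => f (traj f π x₀ d t) (π (traj f π x₀ d t)) (d t)

/-- `π` is robustly safe from `x₀` if every closed-loop trajectory avoids `F` at all times. -/
def RobustlySafe {X U D : Type*} (f : X → U → D → X) (F : Set X) (π : X → U) (x₀ : X) : Prop :=
  ∀ d : ℕ → D, ∀ t : ℕ, traj f π x₀ d t ∉ F

/-- The maximal robust safe set: all states from which some policy is robustly safe. -/
def maxSafeSet {X U D : Type*} (f : X → U → D → X) (F : Set X) : Set X :=
  {x | ∃ π : X → U, RobustlySafe f F π x}

theorem traj_mem_of_invariant {X U D : Type*} {f : X → U → D → X} {π : X → U} {Ω : Set X}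
    (hΩ : ∀ x ∈ Ω, ∀ d : D, f x (π x) d ∈ Ω) {x : X} (hx : x ∈ Ω) (d : ℕ → D) (t : ℕ) :
    traj f π x d t ∈ Ω := by
  induction t with
  | zero => exact hx
  | succ t ih => exact hΩ _ ih (d t)

theorem traj_cons {X U D : Type*} (f : X → U → D → X) (π : X → U) (x : X) (a : D)
    (d : ℕ → D) (t : ℕ) :
    traj f π x (fun n => Nat.casesOn n a d) (t + 1) = traj f π (f x (π x) a) d t := by
  induction t with
  | zero => rfl
  | succ t ih => rw [traj, ih, traj]

theorem RobustlySafe.step {X U D : Type*} {f : X → U → D → X} {F : Set X} {π : X → U} {x : X}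
    (h : RobustlySafe f F π x) (a : D) : RobustlySafe f F π (f x (π x) a) := fun d t => by
  rw [← traj_cons]
  exact h _ (t + 1)

theorem RobustlySafe.notMem {X U D : Type*} [Nonempty D] {f : X → U → D → X} {F : Set X}
    {π : X → U} {x : X} (h : RobustlySafe f F π x) : x ∉ F :=
  h (fun _ => Classical.arbitrary D) 0

theorem robustlySafe_of_invariant {X U D : Type*} {f : X → U → D → X} {F : Set X} {π : X → U}
    {Ω : Set X} (hΩ : ∀ x ∈ Ω, ∀ d : D, f x (π x) d ∈ Ω) (hF : Ω ∩ F = ∅) {x : X}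
    (hx : x ∈ Ω) : RobustlySafe f F π x := fun d t ht =>
  Set.eq_empty_iff_forall_notMem.mp hF _ ⟨traj_mem_of_invariant hΩ hx d t, ht⟩

theorem maxSafeSet_inter_eq_empty {X U D : Type*} [Nonempty D] (f : X → U → D → X)
    (F : Set X) : maxSafeSet f F ∩ F = ∅ :=
  Set.eq_empty_iff_forall_notMem.mpr fun _ ⟨⟨_, h⟩, hx⟩ => h.notMem hx

theorem exists_policy_invariant_maxSafeSet {X U D : Type*} [Nonempty U] (f : X → U → D → X)
    (F : Set X) :
    ∃ π : X → U, ∀ x ∈ maxSafeSet f F, ∀ d : D, f x (π x) d ∈ maxSafeSet f F := by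
  have h : ∀ x, ∃ u : U, x ∈ maxSafeSet f F → ∀ d : D, f x u d ∈ maxSafeSet f F := by
    intro x
    by_cases hx : x ∈ maxSafeSet f F
    · obtain ⟨π, hπ⟩ := hx
      exact ⟨π x, fun _ d => ⟨π, hπ.step d⟩⟩
    · exact ⟨Classical.arbitrary U, fun h => absurd h hx⟩
  choose π hπ using h
  exact ⟨π, hπ⟩

/-- The maximal robust safe set `Ω*`:
(i) it is disjoint from `F`;
(ii) there is a single policy `π` under which `Ω*` is robustly controlled-invariant and
which is robustly safe from every `x ∈ Ω*`;
(iii) every set robustly controlled-invariant under some policy and disjoint from `F`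
is contained in `Ω*`. -/
theorem stmt_1 {X U D : Type*} [Nonempty X] [Nonempty U] [Nonempty D]
    (f : X → U → D → X) (F : Set X) :
    maxSafeSet f F ∩ F = ∅ ∧
    (∃ π : X → U,
      (∀ x ∈ maxSafeSet f F, ∀ d : D, f x (π x) d ∈ maxSafeSet f F) ∧
      (∀ x ∈ maxSafeSet f F, RobustlySafe f F π x)) ∧
    (∀ (Ω : Set X) (π : X → U),
      (∀ x ∈ Ω, ∀ d : D, f x (π x) d ∈ Ω) → Ω ∩ F = ∅ → Ω ⊆ maxSafeSet f F) := by
  obtain ⟨π, hπ⟩ := exists_policy_invariant_maxSafeSet f F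
  have hF := maxSafeSet_inter_eq_empty f F
  exact ⟨hF, ⟨π, hπ, fun _ hx => robustlySafe_of_invariant hπ hF hx⟩,
    fun _ π hΩ hΩF _ hx => ⟨π, robustlySafe_of_invariant hΩ hΩF hx⟩⟩
end

section
/- (Robust Model-Predictive Shielding) Let π_s : X → U be a fallback policy and Ω ⊆ X a terminal safe set with Ω ∩ F = ∅ and ∀ x ∈ Ω, ∀ d ∈ D, f x (π_s x) d ∈ Ω. Fix a horizon H ≥ 1 and define forward-reachable sets R_0(x,u) := {x}, R_1(x,u) := {f x u d | d ∈ D}, and R_{τ+1}(x,u) := {f y (π_s y) d | y ∈ R_τ(x,u), d ∈ D} for τ ≥ 1. Define the switching filter φ x u := u if R_τ(x,u) ∩ F = ∅ for all τ ≤ H and R_H(x,u) ⊆ Ω, and φ x u := π_s x otherwise. Then for every initial state x₀ ∈ Ω, every task policy π_task : X → U, and every disturbance sequence d : ℕ → D, the filtered closed-loop trajectory x_0 = x₀, x_{t+1} = f x_t (φ x_t (π_task x_t)) (d t) satisfies x_t ∉ F for all t ≥ 0. -/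
/-- Forward-reachable sets: `R_0 = {x}`, `R_1 = {f x u d | d ∈ D}`, and for `τ ≥ 1`,
`R_{τ+1} = {f y (πs y) d | y ∈ R_τ, d ∈ D}` (candidate control first, then fallback). -/
def reach {X U D : Type*} (f : X → U → D → X) (πs : X → U) (x : X) (u : U) : ℕ → Set X
  | 0 => {x}
  | 1 => {y | ∃ d : D, y = f x u d}
  | τ + 2 => {y | ∃ z ∈ reach f πs x u (τ + 1), ∃ d : D, y = f z (πs z) d}

open Classical in
/-- Model-predictive shielding switching filter: keep `u` if all reachable sets up to the
horizon avoid `F` and the final reachable set lands in `Ω`; otherwise apply fallback. -/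
noncomputable def mpsFilter {X U D : Type*} (f : X → U → D → X) (πs : X → U)
    (F Ω : Set X) (H : ℕ) (x : X) (u : U) : U :=
  if (∀ τ ≤ H, reach f πs x u τ ∩ F = ∅) ∧ reach f πs x u H ⊆ Ω then u else πs x

/-- States from which the fallback policy `πs` robustly reaches `Ω` while avoiding `F`. -/
inductive Recoverable {X U D : Type*} (f : X → U → D → X) (πs : X → U) (F Ω : Set X) : X → Prop
  | terminal {x : X} : x ∈ Ω → Recoverable f πs F Ω x
  | step {x : X} : x ∉ F → (∀ d : D, Recoverable f πs F Ω (f x (πs x) d)) →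
      Recoverable f πs F Ω x

namespace Recoverable

variable {X U D : Type*} {f : X → U → D → X} {πs : X → U} {F Ω : Set X} {x : X}

theorem notMem (hdisj : Ω ∩ F = ∅) (hx : Recoverable f πs F Ω x) : x ∉ F := by
  cases hx with
  | terminal h => exact fun hF => (hdisj.subset ⟨h, hF⟩ : x ∈ (∅ : Set X))
  | step h _ => exact h

theorem fallback (hinv : ∀ x ∈ Ω, ∀ d : D, f x (πs x) d ∈ Ω)
    (hx : Recoverable f πs F Ω x) (d : D) : Recoverable f πs F Ω (f x (πs x) d) := by
  cases hx with
  | terminal h => exact terminal (hinv x h d)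
  | step _ h => exact h d

theorem of_mem_reach {u : U} {n : ℕ} (hF : ∀ τ ≤ n + 1, reach f πs x u τ ∩ F = ∅)
    (hΩ : reach f πs x u (n + 1) ⊆ Ω) {k : ℕ} (hk : k ≤ n) :
    ∀ y ∈ reach f πs x u (k + 1), Recoverable f πs F Ω y := by
  induction hk using Nat.decreasingInduction with
  | self => exact fun y hy => terminal (hΩ hy)
  | of_succ k hk ih =>
    intro y hy
    refine step (fun hyF => ?_) fun d => ih _ ⟨y, hy, d, rfl⟩
    exact ((hF (k + 1) (by lia)).subset ⟨hy, hyF⟩ : y ∈ (∅ : Set X))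

theorem apply_mpsFilter (hinv : ∀ x ∈ Ω, ∀ d : D, f x (πs x) d ∈ Ω) {H : ℕ} (hH : 1 ≤ H)
    (hx : Recoverable f πs F Ω x) (u : U) (d : D) :
    Recoverable f πs F Ω (f x (mpsFilter f πs F Ω H x u) d) := by
  obtain ⟨n, rfl⟩ := Nat.exists_eq_add_of_le' hH
  unfold mpsFilter
  split_ifs with h
  · exact of_mem_reach h.1 h.2 n.zero_le _ ⟨d, rfl⟩
  · exact hx.fallback hinv d

end Recoverable

/-- Robust Model-Predictive Shielding: if the terminal safe set `Ω` is disjoint from `F`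
and robustly invariant under the fallback `πs`, then from any `x₀ ∈ Ω` the filtered
closed-loop trajectory avoids `F` at all times, for every task policy and disturbance
sequence. -/
theorem stmt_8 {X U D : Type*} [Nonempty X] [Nonempty U] [Nonempty D]
    (f : X → U → D → X) (F : Set X) (πs : X → U) (Ω : Set X)
    (hdisj : Ω ∩ F = ∅)
    (hinv : ∀ x ∈ Ω, ∀ d : D, f x (πs x) d ∈ Ω)
    (H : ℕ) (hH : 1 ≤ H) :
    ∀ x₀ ∈ Ω, ∀ πtask : X → U, ∀ d : ℕ → D, ∀ t : ℕ,
      traj f (fun x => mpsFilter f πs F Ω H x (πtask x)) x₀ d t ∉ F := by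
  intro x₀ hx₀ πtask d t
  refine Recoverable.notMem (f := f) (πs := πs) hdisj ?_
  induction t with
  | zero => exact .terminal hx₀
  | succ t ih => exact ih.apply_mpsFilter hinv hH _ _
end

section
/- (Model-Predictive Safety Filter for Unmapped Environments) Assume: (consistency) ρ (g η u) = f (ρ η) u for all η, u; (monotone mapping) free η ⊆ free (g η u) for all η, u; and fix a horizon H ≥ 1. For η ∈ H' and u ∈ U define the check sequence y_0 := ρ η, y_1 := f y_0 u, y_{j+1} := f y_j u_b for j ≥ 1, and say the monitor passes at (η, u) if y_j ∈ free η for all j ≤ H and y_H is at rest. Define the filter φ η u := u if the monitor passes at (η, u), and φ η u := u_b otherwise. Then for every initial information state η₀ such that ρ η₀ is at rest and ρ η₀ ∈ free η₀, and every task policy π_task : H' → U, the filtered closed-loop trajectory η_0 = η₀, η_{t+1} = g η_t (φ η_t (π_task η_t)) satisfies ρ η_t ∈ free η_t for all t ≥ 0 (the robot never leaves the currently known free space). -/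
/-- Check sequence for the model-predictive safety monitor: `y_0 = z`, `y_1 = f z u`,
and `y_{j+2} = f y_{j+1} u_b` (apply candidate control once, then brake). -/
def check {X U : Type*} (f : X → U → X) (ub : U) (z : X) (u : U) : ℕ → X
  | 0 => z
  | 1 => f z u
  | j + 2 => f (check f ub z u (j + 1)) ub

/-- The monitor passes at `(η, u)` if the check sequence from `ρ η` stays in the
currently known free space for all `j ≤ H` and ends at rest. -/
def monitorPass {X U H' : Type*} (f : X → U → X) (ub : U) (ρ : H' → X)
    (free : H' → Set X) (H : ℕ) (η : H') (u : U) : Prop :=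
  (∀ j ≤ H, check f ub (ρ η) u j ∈ free η) ∧
  f (check f ub (ρ η) u H) ub = check f ub (ρ η) u H

open Classical in
/-- The model-predictive safety filter: keep `u` if the monitor passes, else brake. -/
noncomputable def mpFilter {X U H' : Type*} (f : X → U → X) (ub : U) (ρ : H' → X)
    (free : H' → Set X) (H : ℕ) (η : H') (u : U) : U :=
  if monitorPass f ub ρ free H η u then u else ub

/-- Filtered closed-loop trajectory of information states under task policy `πtask`. -/
noncomputable def itraj {X U H' : Type*} (f : X → U → X) (ub : U) (ρ : H' → X) (free : H' → Set X)
    (H : ℕ) (g : H' → U → H') (πtask : H' → U) (η₀ : H') : ℕ → H'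
  | 0 => η₀
  | t + 1 => g (itraj f ub ρ free H g πtask η₀ t)
      (mpFilter f ub ρ free H (itraj f ub ρ free H g πtask η₀ t)
        (πtask (itraj f ub ρ free H g πtask η₀ t)))

theorem check_succ_eq_iterate {X U : Type*} (f : X → U → X) (ub : U) (z : X) (u : U) (j : ℕ) :
    check f ub z u (j + 1) = (fun x => f x ub)^[j] (f z u) := by
  induction j with
  | zero => rfl
  | succ j ih => rw [Function.iterate_succ_apply', ← ih]; rfl

theorem check_eq_of_rest {X U : Type*} {f : X → U → X} {ub : U} {z : X} {u : U} {H : ℕ}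
    (hH : 1 ≤ H) (hrest : f (check f ub z u H) ub = check f ub z u H) {j : ℕ} (hj : H ≤ j) :
    check f ub z u j = check f ub z u H := by
  induction j, hj using Nat.le_induction with
  | base => rfl
  | succ j hj ih =>
    obtain ⟨k, rfl⟩ := Nat.exists_eq_add_of_le' (hH.trans hj)
    change f (check f ub z u (k + 1)) ub = _
    rw [ih, hrest]

/-- Once the monitor passes, the check sequence stays in the known free space beyond the horizon. -/
theorem monitorPass.check_mem {X U H' : Type*} {f : X → U → X} {ub : U} {ρ : H' → X}
    {free : H' → Set X} {H : ℕ} {η : H'} {u : U} (h : monitorPass f ub ρ free H η u)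
    (hH : 1 ≤ H) (j : ℕ) : check f ub (ρ η) u j ∈ free η := by
  rcases le_total j H with hj | hj
  · exact h.1 j hj
  · rw [check_eq_of_rest hH h.2 hj]
    exact h.1 H le_rfl

/-- Along the filtered trajectory, braking forever keeps the robot in the known free space. -/
theorem iterate_brake_mem_free {X U H' : Type*}
    {f : X → U → X} {ub : U} {ρ : H' → X} {free : H' → Set X} {g : H' → U → H'}
    (hcons : ∀ (η : H') (u : U), ρ (g η u) = f (ρ η) u)
    (hmono : ∀ (η : H') (u : U), free η ⊆ free (g η u))
    {H : ℕ} (hH : 1 ≤ H)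
    {η₀ : H'} (hrest : f (ρ η₀) ub = ρ η₀) (hfree : ρ η₀ ∈ free η₀)
    (πtask : H' → U) (t n : ℕ) :
    (fun x => f x ub)^[n] (ρ (itraj f ub ρ free H g πtask η₀ t)) ∈
      free (itraj f ub ρ free H g πtask η₀ t) := by
  induction t generalizing n with
  | zero =>
    have hfix : (fun x => f x ub)^[n] (ρ η₀) = ρ η₀ := Function.iterate_fixed hrest n
    simpa only [itraj, hfix] using hfree
  | succ t ih =>
    simp only [itraj]
    apply hmono
    rw [hcons, mpFilter]
    split_ifs with hpass
    · rw [← check_succ_eq_iterate]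
      exact hpass.check_mem hH (n + 1)
    · exact ih (n + 1)

/-- Model-Predictive Safety Filter for Unmapped Environments: under consistency of the
information-state dynamics with the physical dynamics and monotone growth of the known
free space, if the robot starts at rest inside the known free space, the filtered
closed-loop trajectory keeps the robot inside the currently known free space forever. -/
theorem stmt_9 {X U H' : Type*} [Nonempty X] [Nonempty U] [Nonempty H']
    (f : X → U → X) (ub : U) (ρ : H' → X) (free : H' → Set X) (g : H' → U → H')
    (hcons : ∀ (η : H') (u : U), ρ (g η u) = f (ρ η) u)
    (hmono : ∀ (η : H') (u : U), free η ⊆ free (g η u))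
    (H : ℕ) (hH : 1 ≤ H)
    (η₀ : H') (hrest : f (ρ η₀) ub = ρ η₀) (hfree : ρ η₀ ∈ free η₀)
    (πtask : H' → U) :
    ∀ t : ℕ,
      ρ (itraj f ub ρ free H g πtask η₀ t) ∈ free (itraj f ub ρ free H g πtask η₀ t) := by
  exact fun t => iterate_brake_mem_free hcons hmono hH hrest hfree πtask t 0
end

section
/- (Game of kind encoded by game of degree, finite horizon) For every n ∈ ℕ and every x ∈ X: W n x ≥ 0 if and only if there exists a time-varying feedback policy π : ℕ → X → U such that for every disturbance sequence d : ℕ → D, the trajectory x_0 = x, x_{t+1} = f x_t (π t x_t) (d t) satisfies g (x_t) ≥ 0 for all t ≤ n. -/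
/-- Finite-horizon safety value functions from the discrete-time Isaacs backward
induction: `W 0 = g`, `W (n+1) x = min (g x) (max_u min_d W n (f x u d))`. -/
noncomputable def W {X U D : Type*} [Fintype U] [Nonempty U] [Fintype D] [Nonempty D]
    (f : X → U → D → X) (g : X → ℝ) : ℕ → X → ℝ
  | 0 => g
  | n + 1 => fun x => min (g x)
      (Finset.univ.sup' Finset.univ_nonempty fun u : U =>
        Finset.univ.inf' Finset.univ_nonempty fun d : D => W f g n (f x u d))

/-- Closed-loop trajectory under a time-varying feedback policy `π : ℕ → X → U`. -/
def tvtraj {X U D : Type*} (f : X → U → D → X) (π : ℕ → X → U) (x₀ : X) (d : ℕ → D) :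
    ℕ → X
  | 0 => x₀
  | t + 1 => f (tvtraj f π x₀ d t) (π t (tvtraj f π x₀ d t)) (d t)

/-- The value function never exceeds the current margin. -/
theorem W_le_margin {X U D : Type*} [Fintype U] [Nonempty U] [Fintype D] [Nonempty D]
    (f : X → U → D → X) (g : X → ℝ) (n : ℕ) (x : X) : W f g n x ≤ g x := by
  cases n with
  | zero => exact le_rfl
  | succ n => exact min_le_left _ _

theorem W_succ_nonneg_iff {X U D : Type*} [Fintype U] [Nonempty U] [Fintype D] [Nonempty D]
    (f : X → U → D → X) (g : X → ℝ) (n : ℕ) (x : X) :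
    0 ≤ W f g (n + 1) x ↔ 0 ≤ g x ∧ ∃ u, ∀ d, 0 ≤ W f g n (f x u d) := by
  simp [W, Finset.le_sup'_iff, Finset.le_inf'_iff]

/-- After one step, the closed-loop trajectory is the trajectory of the shifted policy and
disturbance started at the successor state. -/
theorem tvtraj_succ_eq_shift {X U D : Type*} (f : X → U → D → X) (π : ℕ → X → U) (x : X)
    (d : ℕ → D) (t : ℕ) :
    tvtraj f π x d (t + 1) =
      tvtraj f (fun s => π (s + 1)) (f x (π 0 x) (d 0)) (fun s => d (s + 1)) t := by
  induction t with
  | zero => rfl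
  | succ t ih => rw [tvtraj, ih, tvtraj]

theorem W_nonneg_of_policy {X U D : Type*} [Fintype U] [Nonempty U] [Fintype D] [Nonempty D]
    (f : X → U → D → X) (g : X → ℝ) (n : ℕ) (x : X) (π : ℕ → X → U)
    (hπ : ∀ d : ℕ → D, ∀ t ≤ n, 0 ≤ g (tvtraj f π x d t)) : 0 ≤ W f g n x := by
  have hx : 0 ≤ g x := hπ (fun _ => Classical.arbitrary D) 0 n.zero_le
  induction n generalizing x π with
  | zero => exact hx
  | succ n ih =>
    refine (W_succ_nonneg_iff f g n x).2 ⟨hx, π 0 x, fun e => ?_⟩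
    have hsafe : ∀ d : ℕ → D, ∀ t ≤ n,
        0 ≤ g (tvtraj f (fun s => π (s + 1)) (f x (π 0 x) e) d t) := by
      intro d t ht
      have h := hπ (fun s => Nat.casesOn s e d) (t + 1) (Nat.succ_le_succ ht)
      rwa [tvtraj_succ_eq_shift] at h
    exact ih _ _ hsafe (hsafe (fun _ => e) 0 n.zero_le)

theorem exists_policy_of_W_nonneg {X U D : Type*} [Fintype U] [Nonempty U] [Fintype D]
    [Nonempty D] (f : X → U → D → X) (g : X → ℝ) (n : ℕ) (x : X) (hx : 0 ≤ W f g n x) :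
    ∃ π : ℕ → X → U, ∀ d : ℕ → D, ∀ t ≤ n, 0 ≤ g (tvtraj f π x d t) := by
  have hex : ∀ m y, ∃ u, 0 ≤ W f g (m + 1) y → ∀ d, 0 ≤ W f g m (f y u d) := by
    intro m y
    by_cases hy : 0 ≤ W f g (m + 1) y
    · obtain ⟨-, u, hu⟩ := (W_succ_nonneg_iff f g m y).1 hy
      exact ⟨u, fun _ => hu⟩
    · exact ⟨Classical.arbitrary U, fun h => absurd h hy⟩
  choose κ hκ using hex
  refine ⟨fun t => κ (n - (t + 1)), fun d t ht => ?_⟩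
  suffices h : 0 ≤ W f g (n - t) (tvtraj f (fun t => κ (n - (t + 1))) x d t) from
    h.trans (W_le_margin f g _ _)
  induction t with
  | zero => exact hx
  | succ t ih =>
    have h := ih (Nat.le_of_succ_le ht)
    rw [show n - t = n - (t + 1) + 1 by omega] at h
    exact hκ _ _ h (d t)

/-- Game of kind encoded by game of degree (finite horizon): `W n x ≥ 0` iff there is a
time-varying feedback policy keeping the margin `g` nonnegative for all `t ≤ n` against
every disturbance sequence. -/
theorem stmt_10 {X U D : Type*} [Nonempty X] [Fintype U] [Nonempty U]
    [Fintype D] [Nonempty D] (f : X → U → D → X) (g : X → ℝ) :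
    ∀ (n : ℕ) (x : X),
      W f g n x ≥ 0 ↔
        ∃ π : ℕ → X → U, ∀ d : ℕ → D, ∀ t ≤ n, g (tvtraj f π x d t) ≥ 0 := by
  exact fun n x => ⟨exists_policy_of_W_nonneg f g n x,
    fun ⟨π, hπ⟩ => W_nonneg_of_policy f g n x π hπ⟩
end

section
/- (Convergence to an Isaacs fixed point) Suppose g is bounded below, i.e., there exists B ∈ ℝ with g x ≥ B for all x. Define the infinite-horizon safety value V∞ x := ⨅ n, W n x (which is well defined since each sequence n ↦ W n x is nonincreasing and bounded below). Then V∞ satisfies the infinite-horizon Isaacs fixed-point equation: for all x ∈ X, V∞ x = min (g x) (max over u ∈ U of (min over d ∈ D of V∞ (f x u d))). -/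
section

variable {X U D : Type*} [Fintype U] [Nonempty U] [Fintype D] [Nonempty D]
  (f : X → U → D → X) (g : X → ℝ)

theorem W_succ_apply (n : ℕ) (x : X) :
    W f g (n + 1) x = min (g x)
      (Finset.univ.sup' Finset.univ_nonempty fun u : U =>
        Finset.univ.inf' Finset.univ_nonempty fun d : D => W f g n (f x u d)) :=
  rfl

theorem W_succ_le (n : ℕ) : ∀ x, W f g (n + 1) x ≤ W f g n x := by
  induction n with
  | zero => exact fun x => min_le_left _ _
  | succ n ih =>
    intro x
    rw [W_succ_apply f g (n + 1), W_succ_apply f g n]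
    exact min_le_min_left _ <| Finset.sup'_mono_fun fun u _ =>
      Finset.inf'_mono_fun fun d _ => ih (f x u d)

theorem antitone_W (x : X) : Antitone fun n => W f g n x :=
  antitone_nat_of_succ_le fun n => W_succ_le f g n x

variable {g}

theorem le_W {B : ℝ} (hB : ∀ x, B ≤ g x) (n : ℕ) : ∀ x, B ≤ W f g n x := by
  induction n with
  | zero => exact hB
  | succ n ih =>
    intro x
    rw [W_succ_apply]
    refine le_min (hB x) ?_
    obtain ⟨u⟩ := ‹Nonempty U›
    exact (Finset.le_inf' _ _ fun d _ => ih (f x u d)).trans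
      (Finset.le_sup' (fun u => Finset.univ.inf' Finset.univ_nonempty
        fun d : D => W f g n (f x u d)) (Finset.mem_univ u))

theorem tendsto_W {B : ℝ} (hB : ∀ x, B ≤ g x) (x : X) :
    Filter.Tendsto (fun n => W f g n x) Filter.atTop (nhds (⨅ n, W f g n x)) :=
  tendsto_atTop_ciInf (antitone_W f g x) ⟨B, Set.forall_mem_range.2 fun n => le_W f hB n x⟩

end

/-- Convergence to an Isaacs fixed point: if `g` is bounded below, the infinite-horizon
value `V∞ x := ⨅ n, W n x` satisfies the infinite-horizon Isaacs fixed-point equation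
`V∞ x = min (g x) (max_u min_d V∞ (f x u d))` for all `x`. -/
theorem stmt_13 {X U D : Type*} [Nonempty X] [Fintype U] [Nonempty U]
    [Fintype D] [Nonempty D] (f : X → U → D → X) (g : X → ℝ)
    (hB : ∃ B : ℝ, ∀ x : X, g x ≥ B) :
    ∀ x : X,
      (⨅ n : ℕ, W f g n x) = min (g x)
        (Finset.univ.sup' Finset.univ_nonempty fun u : U =>
          Finset.univ.inf' Finset.univ_nonempty fun d : D =>
            ⨅ n : ℕ, W f g n (f x u d)) := by
  obtain ⟨B, hB⟩ := hB
  intro x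
  refine tendsto_nhds_unique ((Filter.tendsto_add_atTop_iff_nat 1).2 (tendsto_W f hB x)) ?_
  simp only [W_succ_apply]
  exact tendsto_const_nhds.min <| Filter.Tendsto.finset_sup'_nhds_apply _ fun u _ =>
    Filter.Tendsto.finset_inf'_nhds_apply _ fun d _ => tendsto_W f hB (f x u d)
end

section
/- (Safety of an Isaacs fixed point) Let V : X → ℝ satisfy the fixed-point equation V x = min (g x) (max over u ∈ U of (min over d ∈ D of V (f x u d))) for all x, and let F := {x | g x < 0}. Then for every x₀ with V x₀ ≥ 0 there exists a stationary policy π : X → U (e.g., π x ∈ argmax over u of min over d of V (f x u d)) such that for every disturbance sequence d : ℕ → D, the closed-loop trajectory x_0 = x₀, x_{t+1} = f x_t (π x_t) (d t) satisfies V (x_t) ≥ 0, g (x_t) ≥ 0, and x_t ∉ F for all t ≥ 0. -/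
/-- Safety of an Isaacs fixed point: if `V` satisfies the infinite-horizon Isaacs
fixed-point equation, then from every `x₀` with `V x₀ ≥ 0` there is a stationary policy
whose closed-loop trajectories satisfy `V x_t ≥ 0`, `g x_t ≥ 0`, and `x_t ∉ F` for all
times and all disturbance sequences, where `F = {x | g x < 0}`. -/
theorem stmt_14 {X U D : Type*} [Nonempty X] [Fintype U] [Nonempty U]
    [Fintype D] [Nonempty D] (f : X → U → D → X) (g : X → ℝ) (V : X → ℝ)
    (hfix : ∀ x : X, V x = min (g x)
      (Finset.univ.sup' Finset.univ_nonempty fun u : U =>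
        Finset.univ.inf' Finset.univ_nonempty fun d : D => V (f x u d))) :
    ∀ x₀ : X, V x₀ ≥ 0 →
      ∃ π : X → U, ∀ d : ℕ → D, ∀ t : ℕ,
        V (traj f π x₀ d t) ≥ 0 ∧ g (traj f π x₀ d t) ≥ 0 ∧
        traj f π x₀ d t ∉ {x : X | g x < 0} := by
  intro x₀ hx₀
  have hstep : ∀ x : X, ∃ u : U, ∀ d : D, V x ≤ V (f x u d) := by
    intro x
    obtain ⟨u, -, hu⟩ := Finset.exists_mem_eq_sup' Finset.univ_nonempty
      (fun u : U => Finset.univ.inf' Finset.univ_nonempty fun d : D => V (f x u d))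
    refine ⟨u, fun d => ?_⟩
    calc V x ≤ _ := (hfix x).trans_le (min_le_right _ _)
      _ = _ := hu
      _ ≤ V (f x u d) := Finset.inf'_le (fun d : D => V (f x u d)) (Finset.mem_univ d)
  choose π hπ using hstep
  refine ⟨π, fun d t => ?_⟩
  have hV : 0 ≤ V (traj f π x₀ d t) := by
    induction t with
    | zero => exact hx₀
    | succ t ih => exact ih.trans (hπ _ (d t))
  have hg : 0 ≤ g (traj f π x₀ d t) :=
    hV.trans ((hfix _).trans_le (min_le_left _ _))
  exact ⟨hV, hg, not_lt.mpr hg⟩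
end

section
/- (Model-predictive shielding recovers the least-restrictive filter) Let Ω* be the maximal robust safe set and let π* : X → U satisfy ∀ x ∈ Ω*, ∀ d ∈ D, f x (π* x) d ∈ Ω*. Fix a horizon H ≥ 1 and define forward-reachable sets R_0(x,u) := {x}, R_1(x,u) := {f x u d | d ∈ D}, and R_{τ+1}(x,u) := {f y (π* y) d | y ∈ R_τ(x,u), d ∈ D} for τ ≥ 1. Then for every x ∈ X and u ∈ U, the model-predictive shielding check succeeds if and only if the one-step least-restrictive condition holds: (R_τ(x,u) ∩ F = ∅ for all τ ≤ H and R_H(x,u) ⊆ Ω*) ↔ (x ∉ F and ∀ d ∈ D, f x u d ∈ Ω*). -/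
theorem notMem_of_mem_maxSafeSet {X U D : Type*} [Nonempty D] {f : X → U → D → X} {F : Set X}
    {x : X} (hx : x ∈ maxSafeSet f F) : x ∉ F := by
  obtain ⟨π, hπ⟩ := hx
  exact hπ (fun _ => Classical.arbitrary D) 0

theorem reach_succ_subset_of_invariant {X U D : Type*} {f : X → U → D → X} {π : X → U}
    {S : Set X} (hS : ∀ x ∈ S, ∀ d : D, f x (π x) d ∈ S) {x : X} {u : U} {m n : ℕ}
    (hmn : m ≤ n) (hm : reach f π x u (m + 1) ⊆ S) : reach f π x u (n + 1) ⊆ S := by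
  induction n, hmn using Nat.le_induction with
  | base => exact hm
  | succ n _ ih =>
    rintro _ ⟨z, hz, d, rfl⟩
    exact hS z (ih hz) d

theorem traj_mem_reach {X U D : Type*} (f : X → U → D → X) (π : X → U) (x : X) (u : U) (d₀ : D)
    (d : ℕ → D) (t : ℕ) : traj f π (f x u d₀) d t ∈ reach f π x u (t + 1) := by
  induction t with
  | zero => exact ⟨d₀, rfl⟩
  | succ t ih => exact ⟨_, ih, d t, rfl⟩

/-- Model-predictive shielding recovers the least-restrictive filter: if `π*` renders the
maximal robust safe set `Ω*` robustly invariant, then for any horizon `H ≥ 1` the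
model-predictive shielding check (all reachable sets up to `H` avoid `F` and `R_H ⊆ Ω*`)
holds iff the one-step least-restrictive condition holds (`x ∉ F` and every possible
next state under `u` lies in `Ω*`). -/
theorem stmt_16 {X U D : Type*} [Nonempty X] [Nonempty U] [Nonempty D]
    (f : X → U → D → X) (F : Set X) (πopt : X → U)
    (hinv : ∀ x ∈ maxSafeSet f F, ∀ d : D, f x (πopt x) d ∈ maxSafeSet f F)
    (H : ℕ) (hH : 1 ≤ H) :
    ∀ (x : X) (u : U),
      ((∀ τ ≤ H, reach f πopt x u τ ∩ F = ∅) ∧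
        reach f πopt x u H ⊆ maxSafeSet f F) ↔
      (x ∉ F ∧ ∀ d : D, f x u d ∈ maxSafeSet f F) := by
  intro x u
  obtain ⟨H, rfl⟩ := Nat.exists_eq_add_of_le' hH
  constructor
  · rintro ⟨hF, hsub⟩
    have hdisj : ∀ τ ≤ H + 1, ∀ y ∈ reach f πopt x u τ, y ∉ F := fun τ hτ y hy hyF =>
      (hF τ hτ).subset ⟨hy, hyF⟩
    refine ⟨hdisj 0 (Nat.zero_le _) x rfl, fun d₀ => ⟨πopt, fun d t => ?_⟩⟩
    have hmem := traj_mem_reach f πopt x u d₀ d t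
    rcases le_total t H with ht | ht
    · exact hdisj (t + 1) (Nat.succ_le_succ ht) _ hmem
    · exact notMem_of_mem_maxSafeSet (reach_succ_subset_of_invariant hinv ht hsub hmem)
  · rintro ⟨hx, hstep⟩
    have hsafe : ∀ n, reach f πopt x u (n + 1) ⊆ maxSafeSet f F := fun n => by
      refine reach_succ_subset_of_invariant hinv (Nat.zero_le n) ?_
      rintro _ ⟨d, rfl⟩
      exact hstep d
    refine ⟨fun τ _ => Set.eq_empty_iff_forall_notMem.2 ?_, hsafe H⟩
    rintro y ⟨hy, hyF⟩
    cases τ with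
    | zero =>
      obtain rfl : y = x := hy
      exact hx hyF
    | succ n => exact notMem_of_mem_maxSafeSet (hsafe n hy) hyF
end
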